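/- For every positive integer n, the rational function 1/(x^n + y^n) ∈ F(x,y) is (σ_x,σ_y)-summable in F(x,y) if and only if n = 1. In particular, 1/(x + y) = σ_x(x/(x+y)) − x/(x+y) + σ_y((−x−1)/(x+y)) − (−x−1)/(x+y), while for n ≥ 2 there exist no g, h ∈ F(x,y) with 1/(x^n+y^n) = σ_x(g) − g + σ_y(h) − h. -/

import Mathlib

/-- `F(x,y)`, realized as `RatFunc (RatFunc F)` (the inner variable is `x`, the outer is `y`). -/
noncomputable abbrev RatFunc2 (F : Type*) [Field F] : Type _ := RatFunc (RatFunc F)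

/-- The element `x` of `F(x,y)`. -/
noncomputable abbrev RatFunc2.x (F : Type*) [Field F] : RatFunc2 F := RatFunc.C RatFunc.X

/-- The element `y` of `F(x,y)`. -/
noncomputable abbrev RatFunc2.y (F : Type*) [Field F] : RatFunc2 F := RatFunc.X

open Polynomial in
/-- embedding of polynomials -/
noncomputable def SS.iot (F : Type*) [Field F] : F[X][X] →+* RatFunc2 F :=
  (algebraMap (RatFunc F)[X] (RatFunc2 F)).comp (mapRingHom (algebraMap F[X] (RatFunc F)))

namespace SS
open Polynomial

variable {F : Type*} [Field F]

lemma iot_inj : Function.Injective (iot F) := by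
  have h1 : Function.Injective (algebraMap (RatFunc F)[X] (RatFunc2 F)) :=
    IsFractionRing.injective _ _
  have h2 : Function.Injective (mapRingHom (algebraMap F[X] (RatFunc F))) := by
    rw [coe_mapRingHom]
    exact Polynomial.map_injective _ (IsFractionRing.injective _ _)
  exact h1.comp h2

lemma iot_ne {q : F[X][X]} (hq : q ≠ 0) : iot F q ≠ 0 := by
  rw [Ne, map_eq_zero_iff _ iot_inj]; exact hq

lemma iot_Y : iot F X = RatFunc2.y F := by simp [iot, RatFunc2.y]
lemma iot_X : iot F (C X) = RatFunc2.x F := by simp [iot, RatFunc2.x]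
lemma iot_C (a : F) : iot F (C (C a)) = algebraMap F (RatFunc2 F) a := by
  rw [IsScalarTower.algebraMap_apply F (RatFunc F) (RatFunc2 F)]
  simp [iot]

lemma exists_num_den (r : RatFunc2 F) :
    ∃ p q : F[X][X], q ≠ 0 ∧ r = iot F p / iot F q := by
  have key : ∀ p : (RatFunc F)[X], ∃ (b : F[X]) (p' : F[X][X]), b ≠ 0 ∧
      iot F p' = iot F (C b) * algebraMap _ (RatFunc2 F) p := by
    intro p
    obtain ⟨b, hb, h⟩ := IsLocalization.integerNormalization_spec (nonZeroDivisors F[X]) p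
    refine ⟨b, IsLocalization.integerNormalization (nonZeroDivisors F[X]) p,
      nonZeroDivisors.ne_zero hb, ?_⟩
    · rw [iot, RingHom.comp_apply, coe_mapRingHom, h, RingHom.comp_apply, ← map_mul,
        coe_mapRingHom, map_C, ← smul_eq_C_mul, algebraMap_smul]
  obtain ⟨b, p, hb, hp⟩ := key r.num
  obtain ⟨c, q, hc, hq⟩ := key r.denom
  have hb' : iot F (C b) ≠ 0 := iot_ne (by simpa using hb)
  have hc' : iot F (C c) ≠ 0 := iot_ne (by simpa using hc)
  have hd : algebraMap _ (RatFunc2 F) r.denom ≠ 0 := RatFunc.algebraMap_ne_zero r.denom_ne_zero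
  have hq0 : q ≠ 0 := by
    rintro rfl
    rw [map_zero] at hq
    exact mul_ne_zero hc' hd hq.symm
  refine ⟨C c * p, C b * q, mul_ne_zero (by simpa using hb) hq0, ?_⟩
  rw [map_mul, map_mul, hp, hq]
  conv_lhs => rw [← RatFunc.num_div_denom r]
  field_simp

/-- evaluation at `y = β x + c` -/
noncomputable def ev (β c : F) : F[X][X] →+* F[X] := evalRingHom (C β * X + C c)

/-- regular along `y = β x + c` -/
def Good (β c : F) (r : RatFunc2 F) : Prop :=
  ∃ p q : F[X][X], ev β c q ≠ 0 ∧ r = iot F p / iot F q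

lemma ne_of_ev {β c : F} {q : F[X][X]} (h : ev β c q ≠ 0) : q ≠ 0 := by
  rintro rfl; simp at h

lemma Good.add {β c : F} {r s : RatFunc2 F} (hr : Good β c r) (hs : Good β c s) :
    Good β c (r + s) := by
  obtain ⟨p, q, hq, rfl⟩ := hr
  obtain ⟨p', q', hq', rfl⟩ := hs
  refine ⟨p * q' + q * p', q * q', by rw [map_mul]; exact mul_ne_zero hq hq', ?_⟩
  have := iot_ne (ne_of_ev hq)
  have := iot_ne (ne_of_ev hq')
  simp only [map_add, map_mul]
  field_simp

lemma Good.neg {β c : F} {r : RatFunc2 F} (hr : Good β c r) : Good β c (-r) := by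
  obtain ⟨p, q, hq, rfl⟩ := hr
  exact ⟨-p, q, hq, by rw [map_neg]; ring⟩

lemma Good.sub {β c : F} {r s : RatFunc2 F} (hr : Good β c r) (hs : Good β c s) :
    Good β c (r - s) := by
  rw [sub_eq_add_neg]; exact hr.add hs.neg

lemma Good.zero {β c : F} : Good β c (0 : RatFunc2 F) := ⟨0, 1, by simp, by simp⟩

lemma Good.sum {β c : F} {ι : Type*} (s : Finset ι) (f : ι → RatFunc2 F)
    (h : ∀ i ∈ s, Good β c (f i)) : Good β c (∑ i ∈ s, f i) :=
  Finset.sum_induction f (Good β c) (fun _ _ => Good.add) Good.zero h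

lemma good_finite (β : F) (r : RatFunc2 F) : {c | ¬ Good β c r}.Finite := by
  obtain ⟨p, q, hq, rfl⟩ := exists_num_den r
  have hfin : {a | a ∈ q.roots}.Finite := by
    classical
    exact (q.roots.toFinset.finite_toSet).subset (fun a ha => by simpa using ha)
  have : Set.InjOn (fun c : F => (C β * X + C c : F[X]))
      ((fun c : F => (C β * X + C c : F[X])) ⁻¹' {a | a ∈ q.roots}) := by
    intro a _ b _ h
    simpa using h
  refine (hfin.preimage this).subset ?_
  intro c hc
  simp only [Set.mem_preimage, Set.mem_ofPred_eq]
  rw [mem_roots hq]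
  by_contra h
  exact hc ⟨p, q, h, rfl⟩

section shift
variable (σx σy : RatFunc2 F ≃ₐ[F] RatFunc2 F)
    
lemma good_x (hσxx : σx (RatFunc2.x F) = RatFunc2.x F + 1)
    (hσxy : σx (RatFunc2.y F) = RatFunc2.y F) {β c : F} {r : RatFunc2 F}
    (h : Good β (c - β) r) : Good β c (σx r) := by
  obtain ⟨p, q, hq, rfl⟩ := h
  let S : F[X][X] →+* F[X][X] := mapRingHom (compRingHom (X + 1))
  have h1 : (σx : RatFunc2 F →+* RatFunc2 F).comp (iot F) = (iot F).comp S := by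
    ext a
    · simp [S, iot_C]
    · simp [S, iot_X, hσxx]
    · simp [S, iot_Y, hσxy]
  have h1' : ∀ p, σx (iot F p) = iot F (S p) := fun p => RingHom.congr_fun h1 p
  have h2 : (ev β c).comp S = (compRingHom (X + 1)).comp (ev β (c - β)) := by
    ext a
    · simp [S, ev]
    · simp [S, ev]
    · congr 1
      simp [S, ev]
      ring
  have h2' : ev β c (S q) = (ev β (c - β) q).comp (X + 1) := RingHom.congr_fun h2 q
  refine ⟨S p, S q, ?_, by rw [map_div₀, h1', h1']⟩
  rw [h2']
  intro h0
  apply hq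
  have : ((ev β (c - β) q).comp (X + 1)).comp (X - 1) = 0 := by rw [h0, zero_comp]
  simpa [comp_assoc] using this

lemma good_y (hσyx : σy (RatFunc2.x F) = RatFunc2.x F)
    (hσyy : σy (RatFunc2.y F) = RatFunc2.y F + 1) {β c : F} {r : RatFunc2 F}
    (h : Good β (c + 1) r) : Good β c (σy r) := by
  obtain ⟨p, q, hq, rfl⟩ := h
  let S : F[X][X] →+* F[X][X] := compRingHom (X + 1)
  have h1 : (σy : RatFunc2 F →+* RatFunc2 F).comp (iot F) = (iot F).comp S := by
    ext a
    · simp [S, iot_C]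
    · simp [S, iot_X, hσyx]
    · simp [S, iot_Y, hσyy]
  have h1' : ∀ p, σy (iot F p) = iot F (S p) := fun p => RingHom.congr_fun h1 p
  have h2 : (ev β c).comp S = ev β (c + 1) := by
    ext a
    · simp [S, ev]
    · simp [S, ev]
    · simp [S, ev]
      try ring_nf
  have h2' : ev β c (S q) = ev β (c + 1) q := RingHom.congr_fun h2 q
  exact ⟨S p, S q, by rwa [h2'], by rw [map_div₀, h1', h1']⟩

lemma good_xy (hσxx : σx (RatFunc2.x F) = RatFunc2.x F + 1)
    (hσxy : σx (RatFunc2.y F) = RatFunc2.y F) (hσyx : σy (RatFunc2.x F) = RatFunc2.x F)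
    (hσyy : σy (RatFunc2.y F) = RatFunc2.y F + 1) {β : F} {r : RatFunc2 F} (i j : ℕ) {c : F} 
    (h : Good β (c + j - i * β) r) : Good β c ((σx ^ i) ((σy ^ j) r)) := by
  induction i generalizing c with
  | zero =>
    induction j generalizing c with
    | zero => simpa using h
    | succ j ih =>
      rw [pow_succ' σy]
      have := @ih (c + 1) (by convert h using 1; push_cast; ring)
      exact good_y σy hσyx hσyy this
  | succ i ih =>
    rw [pow_succ' σx]
    have := @ih (c - β) (by convert h using 1; push_cast; ring)
    exact good_x σx hσxx hσxy this

lemma commute_xy (hσxx : σx (RatFunc2.x F) = RatFunc2.x F + 1)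
    (hσxy : σx (RatFunc2.y F) = RatFunc2.y F) (hσyx : σy (RatFunc2.x F) = RatFunc2.x F)
    (hσyy : σy (RatFunc2.y F) = RatFunc2.y F + 1) : Commute σx σy := by
  have h1 : ((σx * σy : RatFunc2 F ≃ₐ[F] RatFunc2 F) : RatFunc2 F →+* RatFunc2 F).comp (iot F)
      = ((σy * σx : RatFunc2 F ≃ₐ[F] RatFunc2 F) : RatFunc2 F →+* RatFunc2 F).comp (iot F) := by
    ext a
    · simp [iot_C]
    · simp [iot_X, hσxx, hσyx]
    · simp [iot_Y, hσyy, hσxy]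
  have h1' : ∀ p, (σx * σy) (iot F p) = (σy * σx) (iot F p) := fun p => RingHom.congr_fun h1 p
  apply AlgEquiv.ext
  intro r
  obtain ⟨p, q, hq, rfl⟩ := exists_num_den r
  rw [map_div₀, map_div₀, h1', h1']
end shift

lemma iot_D (n : ℕ) : RatFunc2.x F ^ n + RatFunc2.y F ^ n = iot F (C X ^ n + X ^ n) := by
  rw [map_add, map_pow, map_pow, iot_X, iot_Y]

lemma f_good (n : ℕ) (hn : 0 < n) {β d : F} (hd : d ≠ 0) :
    Good β d (1 / (RatFunc2.x F ^ n + RatFunc2.y F ^ n)) := by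
  rw [iot_D]
  refine ⟨1, C X ^ n + X ^ n, ?_, by rw [map_one]⟩
  intro h
  have := congrArg (eval 0) h
  simp [ev, hn.ne', hd] at this

lemma f_bad (n N : ℕ) {β : F} (hn : 0 < n) (hβ : β ^ n = -1) :
    ¬ Good β (N * β - N) (1 / ((RatFunc2.x F + N) ^ n + (RatFunc2.y F + N) ^ n)) := by
  have e : (RatFunc2.x F + N) ^ n + (RatFunc2.y F + N) ^ n
      = iot F ((C X + ((N : F[X][X]) : F[X][X])) ^ n + (X + ((N : F[X][X]) : F[X][X])) ^ n) := by
    rw [map_add, map_pow, map_pow, map_add, map_add, map_natCast, iot_X, iot_Y]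
  rw [e]
  rintro ⟨p, q, hq, h⟩
  have hD : ((C X + ((N : F[X][X]) : F[X][X])) ^ n + (X + ((N : F[X][X]) : F[X][X])) ^ n : F[X][X]) ≠ 0 := by
    apply ne_of_ev (β := (0 : F)) (c := (1 : F) - (N : F))
    intro h
    have := congrArg (eval (-(N : F))) h
    simp [ev, hn.ne'] at this
  rw [div_eq_div_iff (iot_ne hD) (iot_ne (ne_of_ev hq)), one_mul, ← map_mul] at h
  have := iot_inj h
  apply hq
  rw [this]
  have e2 : ev β (N * β - N) (X + (N : F[X][X]) : F[X][X]) = (C β * (X + (N : F[X])) : F[X]) := by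
    simp [ev]; ring
  have e3 : ev β (N * β - N) (C X + (N : F[X][X]) : F[X][X]) = (X + (N : F[X]) : F[X]) := by
    simp [ev]
  rw [map_mul, map_add, map_pow, map_pow, e2, e3, mul_pow, ← C_pow, hβ]
  simp

lemma pow_x (σ : RatFunc2 F ≃ₐ[F] RatFunc2 F) (z : RatFunc2 F) (h : σ z = z + 1) (N : ℕ) :
    (σ ^ N) z = z + N := by
  induction N with
  | zero => simp
  | succ N ih =>
    rw [pow_succ', AlgEquiv.mul_apply, ih, map_add, h, map_natCast]; push_cast; ring

lemma pow_y (σ : RatFunc2 F ≃ₐ[F] RatFunc2 F) (z : RatFunc2 F) (h : σ z = z) (N : ℕ) :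
    (σ ^ N) z = z := by
  induction N with
  | zero => simp
  | succ N ih => rw [pow_succ', AlgEquiv.mul_apply, ih, h]

lemma exists_beta [IsAlgClosed F] [CharZero F] (n : ℕ) (hn : 2 ≤ n) :
    ∃ β : F, β ^ n = -1 ∧ β ≠ -1 := by
  obtain ⟨b, hb⟩ := IsAlgClosed.exists_pow_nat_eq (-1 : F) (by omega : 0 < n)
  by_cases h : b = -1
  · have : NeZero (n : F) := ⟨by exact_mod_cast (by omega : n ≠ 0)⟩
    have : NeZero n := ⟨by omega⟩
    obtain ⟨z, hz⟩ := HasEnoughRootsOfUnity.exists_primitiveRoot F n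
    refine ⟨b * z, by rw [mul_pow, hb, hz.pow_eq_one, mul_one], ?_⟩
    intro h'
    have : z = 1 := by rw [h] at h'; simpa using h'
    exact hz.ne_one (by omega) this
  · exact ⟨b, hb, h⟩

lemma irr [CharZero F] {n : ℕ} (hn : 2 ≤ n) {β : F} (hβ : β ^ n = -1) (hβ' : β ≠ -1)
    (a b : ℤ) (h : (b : F) = a * β) : a = 0 ∧ b = 0 := by
  have h1 : (b : F) ^ n = - (a : F) ^ n := by rw [h, mul_pow, hβ]; ring
  have h2 : b ^ n = - a ^ n := by exact_mod_cast h1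
  have h3 : b.natAbs ^ n = a.natAbs ^ n := by
    rw [← Int.natAbs_pow, h2, Int.natAbs_neg, Int.natAbs_pow]
  have h4 : b.natAbs = a.natAbs := Nat.pow_left_injective (by omega : n ≠ 0) h3
  by_cases ha : a = 0
  · subst ha; simpa using h4
  exfalso
  have ha' : (a : F) ≠ 0 := by exact_mod_cast ha
  rcases Int.natAbs_eq_natAbs_iff.1 h4 with h5 | h5
  · have : β = 1 := by
      apply mul_left_cancel₀ ha'
      rw [← h, h5, mul_one]
    rw [this, one_pow] at hβ
    have : (2 : F) = 0 := by linear_combination hβ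
    exact two_ne_zero this
  · apply hβ'
    apply mul_left_cancel₀ ha'
    rw [← h, h5]; push_cast; ring

lemma bound [CharZero F] {n : ℕ} (hn : 2 ≤ n) {β : F} (hβ : β ^ n = -1) (hβ' : β ≠ -1)
    (r : RatFunc2 F) : ∃ N : ℕ, ∀ a b : ℤ, (N ≤ a.natAbs ∨ N ≤ b.natAbs) →
      Good β (b - a * β) r := by
  have hinj : Function.Injective (fun p : ℤ × ℤ => (p.2 : F) - p.1 * β) := by
    rintro ⟨a, b⟩ ⟨a', b'⟩ h
    simp only at h
    have := irr hn hβ hβ' (a - a') (b - b') (by push_cast; linear_combination h)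
    ext <;> simp <;> omega
  have hf := (good_finite β r).preimage hinj.injOn
  obtain ⟨N, hN⟩ := (hf.image (fun p : ℤ × ℤ => p.1.natAbs + p.2.natAbs)).bddAbove
  refine ⟨N + 1, fun a b hab => ?_⟩
  by_contra hg
  have := hN ⟨(a, b), hg, rfl⟩
  simp only at this
  omega

lemma not_summable [IsAlgClosed F] [CharZero F] (σx σy : RatFunc2 F ≃ₐ[F] RatFunc2 F)
    (hσxx : σx (RatFunc2.x F) = RatFunc2.x F + 1)
    (hσxy : σx (RatFunc2.y F) = RatFunc2.y F)
    (hσyx : σy (RatFunc2.x F) = RatFunc2.x F)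
    (hσyy : σy (RatFunc2.y F) = RatFunc2.y F + 1) (n : ℕ) (hn : 2 ≤ n) (g h : RatFunc2 F)
    (hs : 1 / (RatFunc2.x F ^ n + RatFunc2.y F ^ n) = σx g - g + σy h - h) : False := by
  obtain ⟨β, hβ, hβ'⟩ := exists_beta (F := F) n hn
  obtain ⟨N₁, hN₁⟩ := bound hn hβ hβ' g
  obtain ⟨N₂, hN₂⟩ := bound hn hβ hβ' h
  set f := 1 / (RatFunc2.x F ^ n + RatFunc2.y F ^ n) with hf
  obtain ⟨N, hNdef⟩ : ∃ N, N = N₁ + N₂ := ⟨_, rfl⟩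
  set M := 2 * N + 1 with hM
  set c : F := N * β - N with hc
  have hgood := fun (r : RatFunc2 F) (i j : ℕ) (H : Good β (c + j - i * β) r) =>
    good_xy σx σy hσxx hσxy hσyx hσyy i j H
  have hcom := commute_xy σx σy hσxx hσxy hσyx hσyy
  have hG : ∀ i j : ℕ, (i = 0 ∨ i = M) → Good β c ((σx ^ i) ((σy ^ j) g)) := by
    intro i j hi
    apply hgood
    have := hN₁ (i - N) (j - N) (by left; omega)
    convert this using 1
    push_cast; ring
  have hH : ∀ i j : ℕ, (j = 0 ∨ j = M) → Good β c ((σx ^ i) ((σy ^ j) h)) := by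
    intro i j hi
    apply hgood
    have := hN₂ (i - N) (j - N) (by right; omega)
    convert this using 1
    push_cast; ring
  have hF : ∀ i j : ℕ, (i, j) ≠ (N, N) → Good β c ((σx ^ i) ((σy ^ j) f)) := by
    intro i j hij
    apply hgood
    apply f_good n (by omega)
    intro h0
    have := irr hn hβ hβ' (i - N) (j - N) (by push_cast; linear_combination h0)
    apply hij
    ext <;> simp <;> omega
  have hsum : Good β c (∑ p ∈ Finset.range M ×ˢ Finset.range M, (σx ^ p.1) ((σy ^ p.2) f)) := by
    have e1 : ∀ p : ℕ × ℕ, (σx ^ p.1) ((σy ^ p.2) f) =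
        ((σx ^ (p.1 + 1)) ((σy ^ p.2) g) - (σx ^ p.1) ((σy ^ p.2) g)) +
        ((σx ^ p.1) ((σy ^ (p.2 + 1)) h) - (σx ^ p.1) ((σy ^ p.2) h)) := by
      intro p
      have hc1 : (σy ^ p.2) (σx g) = σx ((σy ^ p.2) g) := by
        have := (hcom.pow_right p.2).eq
        exact (DFunLike.congr_fun this g).symm
      rw [hs, pow_succ σx, pow_succ σy]
      simp only [AlgEquiv.mul_apply, map_sub, map_add, hc1]
      ring
    simp_rw [e1]
    rw [Finset.sum_add_distrib]
    apply Good.add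
    · rw [Finset.sum_product_right]
      apply Good.sum
      intro j _
      rw [Finset.sum_range_sub (fun i => (σx ^ i) ((σy ^ j) g))]
      exact (hG _ _ (Or.inr rfl)).sub (hG _ _ (Or.inl rfl))
    · rw [Finset.sum_product]
      apply Good.sum
      intro i _
      rw [Finset.sum_range_sub (fun j => (σx ^ i) ((σy ^ j) h))]
      exact (hH _ _ (Or.inr rfl)).sub (hH _ _ (Or.inl rfl))
  have hmem : (N, N) ∈ Finset.range M ×ˢ Finset.range M := by
    simp; omega
  rw [← Finset.add_sum_erase _ _ hmem] at hsum
  have hrest := Good.sum (β := β) (c := c) ((Finset.range M ×ˢ Finset.range M).erase (N, N))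
    (fun p => (σx ^ p.1) ((σy ^ p.2) f)) (fun p hp => hF _ _ (Finset.ne_of_mem_erase hp))
  have hNN := hsum.sub hrest
  rw [add_sub_cancel_right] at hNN
  simp only at hNN
  rw [hf] at hNN
  simp only [map_div₀, map_one, map_add, map_pow, pow_x σx _ hσxx, pow_x σy _ hσyy,
    pow_y σx _ hσxy, pow_y σy _ hσyx, map_natCast] at hNN
  exact f_bad n N (by omega) hβ hNN

end SS

/-- Let `F` be an algebraically closed field of characteristic zero and let `σ_x, σ_y`
be the shift `F`-automorphisms of `F(x,y)` (`σ_x(x) = x+1`, `σ_x(y) = y`, `σ_y(x) = x`,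
`σ_y(y) = y+1`).  For every positive integer `n`, `1/(x^n + y^n)` is
`(σ_x,σ_y)`-summable in `F(x,y)` iff `n = 1`; in particular
`1/(x+y) = σ_x(x/(x+y)) - x/(x+y) + σ_y((-x-1)/(x+y)) - (-x-1)/(x+y)`. -/
theorem shift_summable_inv_xn_add_yn_iff
    (F : Type*) [Field F] [IsAlgClosed F] [CharZero F]
    (σx σy : RatFunc2 F ≃ₐ[F] RatFunc2 F)
    (hσxx : σx (RatFunc2.x F) = RatFunc2.x F + 1)
    (hσxy : σx (RatFunc2.y F) = RatFunc2.y F)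
    (hσyx : σy (RatFunc2.x F) = RatFunc2.x F)
    (hσyy : σy (RatFunc2.y F) = RatFunc2.y F + 1) :
    (∀ n : ℕ, 0 < n →
      ((∃ g h : RatFunc2 F,
          1 / (RatFunc2.x F ^ n + RatFunc2.y F ^ n) = σx g - g + σy h - h)
        ↔ n = 1)) ∧
    1 / (RatFunc2.x F + RatFunc2.y F)
      = σx (RatFunc2.x F / (RatFunc2.x F + RatFunc2.y F))
          - RatFunc2.x F / (RatFunc2.x F + RatFunc2.y F)
        + σy ((-(RatFunc2.x F) - 1) / (RatFunc2.x F + RatFunc2.y F))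
          - (-(RatFunc2.x F) - 1) / (RatFunc2.x F + RatFunc2.y F) := by
  have hxy : RatFunc2.x F + RatFunc2.y F ≠ 0 := by
    have := SS.iot_D (F := F) 1
    rw [pow_one, pow_one] at this
    rw [this]
    apply SS.iot_ne
    apply SS.ne_of_ev (β := 0) (c := 1)
    intro h
    have := congrArg (Polynomial.eval 0) h
    simp [SS.ev] at this
  have hxy1 : RatFunc2.x F + 1 + RatFunc2.y F ≠ 0 := by
    rw [← hσxx, ← hσxy, ← map_add]
    exact (map_ne_zero_iff σx σx.injective).2 hxy
  have key : 1 / (RatFunc2.x F + RatFunc2.y F)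
      = σx (RatFunc2.x F / (RatFunc2.x F + RatFunc2.y F))
          - RatFunc2.x F / (RatFunc2.x F + RatFunc2.y F)
        + σy ((-(RatFunc2.x F) - 1) / (RatFunc2.x F + RatFunc2.y F))
          - (-(RatFunc2.x F) - 1) / (RatFunc2.x F + RatFunc2.y F) := by
    simp only [map_div₀, map_add, map_sub, map_neg, map_one, hσxx, hσxy, hσyx, hσyy]
    generalize RatFunc2.x F = x at *
    generalize RatFunc2.y F = y at *
    have h2 : x + (y + 1) ≠ 0 := by convert hxy1 using 1; ring
    have h3 : x + (y + 1) = x + 1 + y := by ring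
    rw [h3]
    field_simp
    ring
  refine ⟨fun n hn => ⟨?_, ?_⟩, key⟩
  · rintro ⟨g, h, hs⟩
    by_contra hne
    exact SS.not_summable σx σy hσxx hσxy hσyx hσyy n (by omega) g h hs
  · rintro rfl
    rw [pow_one, pow_one]
    exact ⟨_, _, key⟩
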